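/- arXiv:2602.23343 — 5 statements merged into one kernel-verified Lean document; each statement's English description precedes it below -/
import Mathlib

section
/- For every positive integer n, the number of domino tableaux of shape (n,n) equals the central binomial coefficient: #DT((n,n)) = C(n, ⌊n/2⌋). More precisely, the map Φ sending a domino tableau D of shape (n,n) to the set consisting of the labels of all bottom horizontal dominoes of D together with the smallest labels of vertical dominoes of D (taking as many of the latter as needed to reach ⌊n/2⌋ elements) is a bijection from DT((n,n)) to the ⌊n/2⌋-element subsets of {1,…,n}. -/
open scoped Classical

/-- Two cells of the plane (given as (row, column) pairs) are adjacent if they share an edge. -/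
def DominoAdj (c d : ℕ × ℕ) : Prop :=
  (c.1 = d.1 ∧ (c.2 + 1 = d.2 ∨ d.2 + 1 = c.2)) ∨
  (c.2 = d.2 ∧ (c.1 + 1 = d.1 ∨ d.1 + 1 = c.1))

/-- A domino tableau of the shape whose `i`-th row (0-indexed, English notation) has
`rowLen i` cells, with `N` dominoes labeled `1, …, N`.  The label function assigns to each
cell of the diagram the label of the domino covering it (and `0` outside the diagram);
each label in `[1, N]` occupies exactly two edge-adjacent cells (a vertical `2×1` or
horizontal `1×2` domino), and the domino labels strictly increase along rows (left to
right) and down columns: cell labels are weakly increasing, with equal labels in a row or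
column only for the two cells of a single domino. -/
structure DominoTableau (rowLen : ℕ → ℕ) (N : ℕ) where
  label : ℕ × ℕ → ℕ
  support : ∀ c : ℕ × ℕ, label c ≠ 0 ↔ c.2 < rowLen c.1
  bounded : ∀ c : ℕ × ℕ, label c ≤ N
  fiber_domino : ∀ k : ℕ, 1 ≤ k → k ≤ N → ∃ c d : ℕ × ℕ, c ≠ d ∧ DominoAdj c d ∧
    ∀ e : ℕ × ℕ, label e = k ↔ (e = c ∨ e = d)
  row_mono : ∀ i j j' : ℕ, j ≤ j' → j' < rowLen i → label (i, j) ≤ label (i, j')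
  row_strict : ∀ i j j' : ℕ, j < j' → j' < rowLen i → label (i, j) = label (i, j') → j' = j + 1
  col_mono : ∀ i i' j : ℕ, i ≤ i' → j < rowLen i → j < rowLen i' → label (i, j) ≤ label (i', j)
  col_strict : ∀ i i' j : ℕ, i < i' → j < rowLen i → j < rowLen i' →
    label (i, j) = label (i', j) → i' = i + 1

/-- The row-length function of the rectangular shape with `m` rows of length `n`. -/
def rectShape (m n : ℕ) : ℕ → ℕ := fun i => if i < m then n else 0

/-- Domino tableaux of the rectangular shape `(n^m)` (`m` rows, `n` columns). -/
abbrev DTrect (m n : ℕ) := DominoTableau (rectShape m n) (m * n / 2)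

/-- Domino tableaux of shape `(n, n)`, i.e. the `2 × n` rectangle, with `n` dominoes. -/
abbrev DT2 (n : ℕ) := DominoTableau (rectShape 2 n) n

/-- `k` is the label of a bottom horizontal domino of `D` (a horizontal domino in row 2,
which is row index `1` here). -/
def IsBottomHorizontal (n : ℕ) (D : DT2 n) (k : ℕ) : Prop :=
  ∃ j : ℕ, j + 1 < n ∧ D.label (1, j) = k ∧ D.label (1, j + 1) = k

/-- `k` is the label of a vertical domino of `D`. -/
def IsVertical (n : ℕ) (D : DT2 n) (k : ℕ) : Prop :=
  ∃ j : ℕ, j < n ∧ D.label (0, j) = k ∧ D.label (1, j) = k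

/-- The set of labels of bottom horizontal dominoes of `D` (the "reduced subset"). -/
def bhSet (n : ℕ) (D : DT2 n) : Set ℕ := {k | IsBottomHorizontal n D k}

/-- The set of labels of vertical dominoes of `D`. -/
def vertSet (n : ℕ) (D : DT2 n) : Set ℕ := {k | IsVertical n D k}

/-- The map `Φ`: the labels of all bottom horizontal dominoes of `D`, together with the
smallest labels of vertical dominoes of `D`, taking as many of the latter as needed to
reach `⌊n/2⌋` elements. -/
def Phi (n : ℕ) (D : DT2 n) : Set ℕ :=
  bhSet n D ∪
    {v | v ∈ vertSet n D ∧ (vertSet n D ∩ Set.Iic v).ncard ≤ n / 2 - (bhSet n D).ncard}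

/-- A lattice path of length `n` from height `0` to height `0`, with unit up and down steps and
with flat steps only at height `0`. Beyond `n` it is constantly `0`. -/
structure IsPath (n : ℕ) (d : ℕ → ℕ) : Prop where
  zero : d 0 = 0
  eq_zero : ∀ k, n ≤ k → d k = 0
  step : ∀ k, d (k + 1) = d k + 1 ∨ d k = d (k + 1) + 1 ∨ d k = 0 ∧ d (k + 1) = 0

/-- The step of `d` from `k` to `k + 1` goes down. -/
def IsDown (d : ℕ → ℕ) (k : ℕ) : Prop := d k = d (k + 1) + 1

/-- The step of `d` from `k` to `k + 1` is a flat step at height `0`. -/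
def IsFlat (d : ℕ → ℕ) (k : ℕ) : Prop := d k = 0 ∧ d (k + 1) = 0

/-- The steps selected by `Φ`: all down steps, and the first flat steps, as many as needed to
reach `⌊n/2⌋` steps. -/
def IsSelected (n : ℕ) (d : ℕ → ℕ) (k : ℕ) : Prop :=
  IsDown d k ∨ IsFlat d k ∧ Nat.count (IsFlat d) k < n / 2 - Nat.count (IsDown d) n

/-- The set of `k + 1` with `k < n` and `p k`. -/
def succSet (n : ℕ) (p : ℕ → Prop) : Set ℕ := {x | ∃ k < n, p k ∧ k + 1 = x}

/-- The path `d` records the shapes of the subtableaux of `D`: the labels at most `k` fill the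
first `k + d k` cells of the top row and the first `k - d k` cells of the bottom row. -/
structure Encodes {n : ℕ} (D : DT2 n) (d : ℕ → ℕ) : Prop where
  path : IsPath n d
  top : ∀ j k, j < n → (D.label (0, j) ≤ k ↔ j < k + d k)
  bottom : ∀ j k, j < n → (D.label (1, j) ≤ k ↔ j + d k < k)

section succSet

variable {n : ℕ} {p : ℕ → Prop}

lemma succ_mem_succSet {k : ℕ} : k + 1 ∈ succSet n p ↔ k < n ∧ p k := by
  simp [succSet]

lemma zero_notMem_succSet : 0 ∉ succSet n p := by
  simp [succSet]

lemma ncard_succSet [DecidablePred p] : (succSet n p).ncard = Nat.count p n := by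
  have : succSet n p = (fun k => k + 1) '' (↑((Finset.range n).filter p) : Set ℕ) := by
    ext x
    simp [succSet, and_assoc]
  rw [this, Set.ncard_image_of_injective _ (add_left_injective 1), Set.ncard_coe_finset,
    Nat.count_eq_card_filter_range]

lemma succSet_inter_Iic {k : ℕ} (hk : k < n) :
    succSet n p ∩ Set.Iic (k + 1) = succSet (k + 1) p := by
  ext x
  rcases x with _ | x
  · simp [zero_notMem_succSet]
  · simp only [Set.mem_inter_iff, succ_mem_succSet, Set.mem_Iic]
    grind

lemma succSet_subset_Icc : succSet n p ⊆ Set.Icc 1 n := by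
  rintro x ⟨k, hk, -, rfl⟩
  simp; omega

lemma eq_succSet_of_subset_Icc {S : Set ℕ} (hS : S ⊆ Set.Icc 1 n) :
    S = succSet n (fun k => k + 1 ∈ S) := by
  ext x
  rcases x with _ | x
  · simp only [zero_notMem_succSet, iff_false]
    intro h
    simpa using hS h
  · rw [succ_mem_succSet]
    refine ⟨fun h => ⟨?_, h⟩, fun h => h.2⟩
    have := (hS h).2
    omega

end succSet

lemma count_congr_of_lt {p q : ℕ → Prop} [DecidablePred p] [DecidablePred q] {n : ℕ}
    (h : ∀ k < n, p k ↔ q k) {k : ℕ} (hk : k ≤ n) : Nat.count p k = Nat.count q k := by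
  induction k with
  | zero => simp
  | succ k ih => simp only [Nat.count_succ, ih (by omega), h k (by omega)]

namespace IsPath

variable {n : ℕ} {d e : ℕ → ℕ}

lemma le_self (hd : IsPath n d) (k : ℕ) : d k ≤ k := by
  induction k with
  | zero => simp [hd.zero]
  | succ k ih => have := hd.step k; omega

lemma add_count (hd : IsPath n d) (k : ℕ) :
    d k + 2 * Nat.count (IsDown d) k + Nat.count (IsFlat d) k = k := by
  induction k with
  | zero => simp [hd.zero]
  | succ k ih =>
    have := hd.step k
    rw [Nat.count_succ, Nat.count_succ]
    unfold IsDown IsFlat at *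
    split_ifs <;> omega

lemma count_isSelected (hd : IsPath n d) (k : ℕ) :
    Nat.count (IsSelected n d) k = Nat.count (IsDown d) k +
      min (Nat.count (IsFlat d) k) (n / 2 - Nat.count (IsDown d) n) := by
  induction k with
  | zero => simp
  | succ k ih =>
    have := hd.step k
    simp only [Nat.count_succ, ih]
    unfold IsSelected
    have : ¬ (IsDown d k ∧ IsFlat d k) := by unfold IsDown IsFlat; omega
    grind

lemma count_isSelected_eq (hd : IsPath n d) : Nat.count (IsSelected n d) n = n / 2 := by
  have h1 := hd.count_isSelected n
  have h2 := hd.add_count n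
  have h3 := hd.eq_zero n le_rfl
  omega

/-- A path returns to height `0` without flat steps in between. -/
lemma exists_return (hd : IsPath n d) {k : ℕ} (hk : k ≤ n) :
    ∃ j, k ≤ j ∧ j ≤ n ∧ d j = 0 ∧ Nat.count (IsFlat d) j = Nat.count (IsFlat d) k := by
  induction hk using Nat.decreasingInduction with
  | self => exact ⟨n, le_rfl, le_rfl, hd.eq_zero n le_rfl, rfl⟩
  | of_succ k hk ih =>
    by_cases h0 : d k = 0
    · exact ⟨k, le_rfl, hk.le, h0, rfl⟩
    · obtain ⟨j, h1, h2, h3, h4⟩ := ih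
      refine ⟨j, by omega, h2, h3, ?_⟩
      rw [h4, Nat.count_succ, if_neg (fun h => h0 h.1), add_zero]

/-- The number of flat steps attains every value up to its final one at height `0`. -/
lemma exists_count_isFlat_eq (hd : IsPath n d) {m k : ℕ} (hk : k ≤ n)
    (hm : m ≤ Nat.count (IsFlat d) k) :
    ∃ j ≤ n, d j = 0 ∧ Nat.count (IsFlat d) j = m := by
  induction k with
  | zero => exact ⟨0, by omega, hd.zero, by simp at hm ⊢; omega⟩
  | succ k ih =>
    by_cases hm' : m ≤ Nat.count (IsFlat d) k
    · exact ih (by omega) hm'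
    · rw [Nat.count_succ] at hm
      split_ifs at hm with h
      · exact ⟨k + 1, hk, h.2, by rw [Nat.count_succ, if_pos h]; omega⟩
      · omega

lemma sub_count_le (hd : IsPath n d) (he : IsPath n e)
    (h : ∀ k < n, IsSelected n d k ↔ IsSelected n e k) :
    n / 2 - Nat.count (IsDown d) n ≤ n / 2 - Nat.count (IsDown e) n := by
  have hn := hd.add_count n
  have hz := hd.eq_zero n le_rfl
  obtain ⟨j, hj, h0, hc⟩ := hd.exists_count_isFlat_eq (m := n / 2 - Nat.count (IsDown d) n)
    le_rfl (by omega)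
  have h1 := hd.count_isSelected j
  have h2 := he.count_isSelected j
  have h3 := hd.add_count j
  have h4 := he.add_count j
  have h5 := count_congr_of_lt h hj
  omega

/-- If two paths have the same selected steps and agree up to `k`, then a flat step of the first
one at `k` forces that of the second one. -/
lemma isFlat_of_isFlat (hd : IsPath n d) (he : IsPath n e)
    (h : ∀ k < n, IsSelected n d k ↔ IsSelected n e k) {k : ℕ} (hk : k < n)
    (hde : d k = e k) (hc : Nat.count (IsFlat d) k = Nat.count (IsFlat e) k)
    (hf : IsFlat d k) : IsFlat e k := by
  have hm := le_antisymm (hd.sub_count_le he h) (he.sub_count_le hd fun k hk => (h k hk).symm)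
  by_contra hne
  have hs := h k hk
  have hstep := he.step k
  have hnd : ¬ IsDown d k := by unfold IsDown IsFlat at *; omega
  have hned : ¬ IsDown e k := by unfold IsDown IsFlat at *; omega
  simp only [IsSelected, hnd, hned, hne, hf, false_or, false_and, true_and, iff_false] at hs
  obtain ⟨j, h1, h2, h3, h4⟩ := he.exists_return (k := k + 1) hk
  have h5 := he.count_isSelected j
  have h6 := hd.count_isSelected j
  have h7 := hd.add_count j
  have h8 := he.add_count j
  have h9 := count_congr_of_lt h h2
  have h10 := Nat.count_monotone (IsFlat d) h1
  rw [Nat.count_succ, if_neg hne] at h4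
  rw [Nat.count_succ, if_pos hf] at h10
  omega

/-- A path is determined by its selected steps. -/
lemma eq_of_isSelected_iff (hd : IsPath n d) (he : IsPath n e)
    (h : ∀ k < n, IsSelected n d k ↔ IsSelected n e k) : d = e := by
  have key : ∀ k ≤ n, d k = e k ∧ Nat.count (IsFlat d) k = Nat.count (IsFlat e) k := by
    intro k hk
    induction k with
    | zero => simp [hd.zero, he.zero]
    | succ k ih =>
      obtain ⟨h1, h2⟩ := ih (by omega)
      have hf : IsFlat d k ↔ IsFlat e k :=
        ⟨hd.isFlat_of_isFlat he h hk h1 h2,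
          he.isFlat_of_isFlat hd (fun k hk => (h k hk).symm) hk h1.symm h2.symm⟩
      refine ⟨?_, by simp only [Nat.count_succ, h2, hf]⟩
      have hs := h k hk
      have := hd.step k
      have := he.step k
      by_cases hfd : IsFlat d k
      · exact hfd.2.trans (hf.1 hfd).2.symm
      · simp only [IsSelected, hfd, hf.not.1 hfd, false_and, or_false] at hs
        unfold IsDown IsFlat at *
        omega
  funext k
  rcases le_total k n with hk | hk
  · exact (key k hk).1
  · rw [hd.eq_zero k hk, he.eq_zero k hk]

end IsPath

/-- Running minimum of `h` from the left. -/
def runningMin (h : ℕ → ℤ) : ℕ → ℤ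
  | 0 => h 0
  | k + 1 => min (runningMin h k) (h (k + 1))

lemma runningMin_le (h : ℕ → ℤ) (k : ℕ) : runningMin h k ≤ h k := by
  cases k <;> simp [runningMin]

lemma exists_finalMin (h : ℕ → ℤ) (n : ℕ) :
    ∃ R : ℕ → ℤ, R n = h n ∧ ∀ k < n, R k = min (h k) (R (k + 1)) := by
  refine ⟨fun k => runningMin (fun i => h (n - i)) (n - k), by simp [runningMin], fun k hk => ?_⟩
  obtain ⟨i, rfl⟩ := Nat.exists_eq_add_of_lt hk
  have h1 : k + i + 1 - k = i + 1 := by omega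
  have h2 : k + i + 1 - (k + 1) = i := by omega
  have h3 : k + i + 1 - (i + 1) = k := by omega
  simp only [h1, h2, h3, runningMin, min_comm]

/-- Every set of `⌊n/2⌋` steps is the set of selected steps of a path. -/
lemma exists_isPath_isSelected_iff {n : ℕ} {s : ℕ → Prop} [DecidablePred s]
    (hs : Nat.count s n = n / 2) :
    ∃ d, IsPath n d ∧ ∀ k < n, IsSelected n d k ↔ s k := by
  obtain ⟨h, hh⟩ : ∃ h : ℕ → ℤ, ∀ k, h k = k - 2 * Nat.count s k := ⟨_, fun _ => rfl⟩
  obtain ⟨R, hRn, hR⟩ := exists_finalMin h n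
  set L := runningMin h with hL
  have hL0 : L 0 = 0 := by simp [hL, runningMin, hh]
  have hLs : ∀ k, L (k + 1) = min (L k) (h (k + 1)) := fun k => rfl
  have hLh : ∀ k, L k ≤ h k := runningMin_le h
  have hRh : ∀ k ≤ n, R k ≤ h k := by
    intro k hk
    rcases hk.eq_or_lt with rfl | hk
    · exact hRn.le
    · rw [hR k hk]; exact min_le_left _ _
  have hh0 : h 0 = 0 := by simp [hh]
  have hstep : ∀ k, s k ∧ h (k + 1) = h k - 1 ∨ ¬ s k ∧ h (k + 1) = h k + 1 := by
    intro k
    by_cases hk : s k <;> simp [hh, Nat.count_succ, hk] <;> ring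
  have hmin : ∀ k ≤ n, min (L k) (R k) = R 0 := by
    intro k hk
    induction k with
    | zero => have := hRh 0 hk; omega
    | succ k ih =>
      have := ih (by omega)
      have := hRh (k + 1) hk
      have := hLh k
      have := hR k hk
      have := hLs k
      omega
  obtain ⟨d, hd⟩ : ∃ d : ℕ → ℕ, ∀ k, d k = if k < n then (h k - max (L k) (R k)).toNat else 0 :=
    ⟨_, fun _ => rfl⟩
  have hdk : ∀ k ≤ n, (d k : ℤ) = h k - max (L k) (R k) := by
    intro k hk
    rw [hd]
    have := hLh k
    have := hRh k hk
    split_ifs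
    · omega
    · obtain rfl : k = n := by omega
      omega
  have hpath : IsPath n d := by
    refine ⟨?_, fun k hk => by rw [hd, if_neg (by omega)], fun k => ?_⟩
    · have := hdk 0 (by omega)
      have := hRh 0 (by omega)
      omega
    · by_cases hk : k < n
      · have := hdk k hk.le
        have := hdk (k + 1) hk
        have := hR k hk
        have := hLs k
        have := hLh k
        have := hRh (k + 1) hk
        have := hstep k
        omega
      · exact .inr (.inr ⟨by rw [hd, if_neg hk], by rw [hd, if_neg (by omega)]⟩)
  have hflat : ∀ k ≤ n, (Nat.count (IsFlat d) k : ℤ) = R k - L k - R 0 := by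
    intro k hk
    induction k with
    | zero => simp [hL0]
    | succ k ih =>
      have := ih (by omega)
      have := hdk k (by omega)
      have := hdk (k + 1) hk
      have := hR k hk
      have := hLs k
      have := hLh k
      have := hRh (k + 1) hk
      have := hstep k
      rw [Nat.count_succ]
      unfold IsFlat at *
      split_ifs <;> push_cast <;> omega
  refine ⟨d, hpath, fun k hk => ?_⟩
  have := hpath.add_count n
  have := hpath.eq_zero n le_rfl
  have := hflat n le_rfl
  have := hmin n le_rfl
  have := hLh n
  have := hh n
  have hm : ((n / 2 - Nat.count (IsDown d) n : ℕ) : ℤ) = - R 0 := by omega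
  have := hflat k hk.le
  have := hdk k hk.le
  have := hdk (k + 1) hk
  have := hR k hk
  have := hLs k
  have := hLh k
  have := hRh (k + 1) hk
  unfold IsSelected
  generalize n / 2 - Nat.count (IsDown d) n = m at *
  generalize Nat.count (IsFlat d) k = v at *
  unfold IsDown IsFlat
  rcases hstep k with ⟨hsk, _⟩ | ⟨hsk, _⟩
  · simp only [hsk, iff_true]; omega
  · simp only [hsk, iff_false]; omega

namespace DominoTableau

lemma ext_label {r : ℕ → ℕ} {N : ℕ} {D E : DominoTableau r N} (h : D.label = E.label) :
    D = E := by
  cases D; cases E; cases h; rfl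

end DominoTableau

lemma lt_rectShape_two {n i j : ℕ} : j < rectShape 2 n i ↔ (i = 0 ∨ i = 1) ∧ j < n := by
  unfold rectShape
  split_ifs <;> omega

namespace Encodes

variable {n : ℕ} {D E : DT2 n} {d : ℕ → ℕ}

lemma top_eq (h : Encodes D d) {j k : ℕ} (hj : j < n) :
    D.label (0, j) = k + 1 ↔ k + d k ≤ j ∧ j < k + 1 + d (k + 1) := by
  have := h.top j k hj
  have := h.top j (k + 1) hj
  omega

lemma bottom_eq (h : Encodes D d) {j k : ℕ} (hj : j < n) :
    D.label (1, j) = k + 1 ↔ k ≤ j + d k ∧ j + d (k + 1) < k + 1 := by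
  have := h.bottom j k hj
  have := h.bottom j (k + 1) hj
  omega

lemma bhSet_eq (h : Encodes D d) : bhSet n D = succSet n (IsDown d) := by
  ext x
  rcases x with _ | k
  · simp only [zero_notMem_succSet, iff_false]
    rintro ⟨j, hj, h0, -⟩
    exact (D.support (1, j)).2 (lt_rectShape_two.2 ⟨.inr rfl, by simp; omega⟩) h0
  · rw [succ_mem_succSet]
    have hstep := h.path.step k
    have hle := h.path.le_self k
    unfold IsDown
    constructor
    · rintro ⟨j, hj, h1, h2⟩
      have hb := D.bounded (1, j)
      rw [h.bottom_eq (by omega)] at h2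
      have h1' := (h.bottom_eq (by omega)).1 h1
      omega
    · rintro ⟨hk, hd⟩
      refine ⟨k - d k, by omega, ?_, ?_⟩ <;> rw [h.bottom_eq (by omega)] <;> omega

lemma vertSet_eq (h : Encodes D d) : vertSet n D = succSet n (IsFlat d) := by
  ext x
  rcases x with _ | k
  · simp only [zero_notMem_succSet, iff_false]
    rintro ⟨j, hj, -, h0⟩
    exact (D.support (1, j)).2 (lt_rectShape_two.2 ⟨.inr rfl, hj⟩) h0
  · rw [succ_mem_succSet]
    have hstep := h.path.step k
    unfold IsFlat
    constructor
    · rintro ⟨j, hj, h1, h2⟩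
      have h1' := (h.top_eq hj).1 h1
      have h2' := (h.bottom_eq hj).1 h2
      omega
    · rintro ⟨hk, hd⟩
      refine ⟨k, hk, ?_, ?_⟩
      · rw [h.top_eq hk]; omega
      · rw [h.bottom_eq hk]; omega

lemma Phi_eq (h : Encodes D d) : Phi n D = succSet n (IsSelected n d) := by
  unfold Phi
  rw [h.bhSet_eq, h.vertSet_eq, ncard_succSet]
  ext x
  rcases x with _ | k
  · simp [zero_notMem_succSet]
  · by_cases hk : k < n
    · simp only [Set.mem_union, Set.mem_ofPred_eq, succ_mem_succSet, succSet_inter_Iic hk,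
        ncard_succSet, hk, true_and, IsSelected]
      refine or_congr_right (and_congr_right fun hf => ?_)
      rw [Nat.count_succ, if_pos hf, Nat.succ_le_iff]
    · simp [succ_mem_succSet, hk]

lemma unique (hD : Encodes D d) (hE : Encodes E d) : D = E := by
  apply DominoTableau.ext_label
  funext ⟨i, j⟩
  by_cases hc : (i = 0 ∨ i = 1) ∧ j < n
  · obtain ⟨rfl | rfl, hj⟩ := hc
    · exact eq_of_forall_ge_iff fun k => (hD.top j k hj).trans (hE.top j k hj).symm
    · exact eq_of_forall_ge_iff fun k => (hD.bottom j k hj).trans (hE.bottom j k hj).symm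
  · have h1 := (D.support (i, j)).not.2 (fun h => hc (lt_rectShape_two.1 h))
    have h2 := (E.support (i, j)).not.2 (fun h => hc (lt_rectShape_two.1 h))
    rw [not_not.1 h1, not_not.1 h2]

end Encodes

lemma exists_threshold {n : ℕ} {f : ℕ → ℕ} (hf : ∀ i j, i ≤ j → j < n → f i ≤ f j) (k : ℕ) :
    ∃ a ≤ n, ∀ j < n, f j ≤ k ↔ j < a := by
  have hex : ∃ a, a = n ∨ k < f a := ⟨n, .inl rfl⟩
  have hle : Nat.find hex ≤ n := Nat.find_min' hex (.inl rfl)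
  refine ⟨Nat.find hex, hle, fun j hj => ⟨fun h => ?_, fun h => ?_⟩⟩
  · by_contra hlt
    rcases Nat.find_spec hex with h' | h'
    · omega
    · have := hf _ j (not_lt.1 hlt) hj
      omega
  · have := Nat.find_min hex h
    omega

lemma eq_of_Ico_iff {n a a' u l : ℕ} (haa : a ≤ a') (han : a' ≤ n) (hul : u + l ≤ n)
    (h : ∀ x < n, (a ≤ x ∧ x < a') ↔ (u ≤ x ∧ x < u + l)) : a' = a + l ∧ (0 < l → a = u) := by
  have := h a
  have := h (a' - 1)
  have := h u
  have := h (u + l - 1)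
  omega

lemma exists_encodes {n : ℕ} (D : DT2 n) : ∃ d, Encodes D d := by
  have hrow : ∀ i, (i = 0 ∨ i = 1) → ∀ x y, x ≤ y → y < n → D.label (i, x) ≤ D.label (i, y) :=
    fun i hi x y hxy hy => D.row_mono i x y hxy (lt_rectShape_two.2 ⟨hi, hy⟩)
  choose a han ha using exists_threshold (hrow 0 (.inl rfl))
  choose b hbn hb using exists_threshold (hrow 1 (.inr rfl))
  have hpos : ∀ i, (i = 0 ∨ i = 1) → ∀ j < n, D.label (i, j) ≠ 0 :=
    fun i hi j hj => (D.support (i, j)).2 (lt_rectShape_two.2 ⟨hi, hj⟩)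
  have hba : ∀ k, b k ≤ a k := by
    intro k
    by_contra hlt
    have hn : a k < n := by have := hbn k; omega
    have h1 := ha k (a k) hn
    have h2 := hb k (a k) hn
    have h3 := D.col_mono 0 1 (a k) (by omega) (lt_rectShape_two.2 ⟨.inl rfl, hn⟩)
      (lt_rectShape_two.2 ⟨.inr rfl, hn⟩)
    omega
  have ha0 : a 0 = 0 := by
    by_contra h
    have hn : 0 < n := by have := han 0; omega
    have h1 := ha 0 0 hn
    have h2 := hpos 0 (.inl rfl) 0 hn
    omega
  have hb0 : b 0 = 0 := by have := hba 0; omega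
  have hbN : ∀ k, n ≤ k → b k = n := by
    intro k hk
    by_contra h
    have hn : b k < n := by have := hbn k; omega
    have h1 := hb k (b k) hn
    have h2 := D.bounded (1, b k)
    omega
  have haN : ∀ k, n ≤ k → a k = n := by
    intro k hk
    have := hbN k hk
    have := hba k
    have := han k
    omega
  have hstep : ∀ k < n, (a (k + 1) = a k + 2 ∧ b (k + 1) = b k) ∨
      (a (k + 1) = a k ∧ b (k + 1) = b k + 2) ∨
      (a k = b k ∧ a (k + 1) = a k + 1 ∧ b (k + 1) = b k + 1) := by
    intro k hk
    obtain ⟨⟨ci, cj⟩, ⟨di, dj⟩, -, hadj, hfib⟩ := D.fiber_domino (k + 1) (by omega) hk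
    have hc := (hfib (ci, cj)).2 (.inl rfl)
    have hd := (hfib (di, dj)).2 (.inr rfl)
    have hcs := lt_rectShape_two.1 ((D.support (ci, cj)).1 (by omega))
    have hds := lt_rectShape_two.1 ((D.support (di, dj)).1 (by omega))
    have h0 : ∀ x < n, (a k ≤ x ∧ x < a (k + 1)) ↔ (0 = ci ∧ x = cj ∨ 0 = di ∧ x = dj) := by
      intro x hx
      have h1 := ha k x hx
      have h2 := ha (k + 1) x hx
      have h3 := hfib (0, x)
      simp only [Prod.mk.injEq] at h3
      rw [← h3]
      omega
    have h1 : ∀ x < n, (b k ≤ x ∧ x < b (k + 1)) ↔ (1 = ci ∧ x = cj ∨ 1 = di ∧ x = dj) := by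
      intro x hx
      have h1 := hb k x hx
      have h2 := hb (k + 1) x hx
      have h3 := hfib (1, x)
      simp only [Prod.mk.injEq] at h3
      rw [← h3]
      omega
    have ham : a k ≤ a (k + 1) := by
      by_contra hlt
      have hn : a (k + 1) < n := by have := han k; omega
      have := ha k _ hn
      have := ha (k + 1) _ hn
      omega
    have hbm : b k ≤ b (k + 1) := by
      by_contra hlt
      have hn : b (k + 1) < n := by have := hbn k; omega
      have := hb k _ hn
      have := hb (k + 1) _ hn
      omega
    have hA := fun u l => eq_of_Ico_iff (u := u) (l := l) ham (han (k + 1))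
    have hB := fun u l => eq_of_Ico_iff (u := u) (l := l) hbm (hbn (k + 1))
    simp only [DominoAdj] at hadj
    obtain ⟨rfl | rfl, _⟩ := hcs <;> obtain ⟨rfl | rfl, _⟩ := hds
    · have := hA (min cj dj) 2 (by omega) fun x hx => by rw [h0 x hx]; omega
      have := hB 0 0 (by omega) fun x hx => by rw [h1 x hx]; omega
      omega
    · have := hA cj 1 (by omega) fun x hx => by rw [h0 x hx]; omega
      have := hB cj 1 (by omega) fun x hx => by rw [h1 x hx]; omega
      omega
    · have := hA cj 1 (by omega) fun x hx => by rw [h0 x hx]; omega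
      have := hB cj 1 (by omega) fun x hx => by rw [h1 x hx]; omega
      omega
    · have := hA 0 0 (by omega) fun x hx => by rw [h0 x hx]; omega
      have := hB (min cj dj) 2 (by omega) fun x hx => by rw [h1 x hx]; omega
      omega
  have hsum : ∀ k ≤ n, a k + b k = 2 * k := by
    intro k hk
    induction k with
    | zero => omega
    | succ k ih =>
      have := ih (by omega)
      have := hstep k hk
      omega
  refine ⟨fun k => a k - k, ⟨by simp [ha0], fun k hk => by simp [haN k hk, hk], fun k => ?_⟩,
    fun j k hj => ?_, fun j k hj => ?_⟩
  · by_cases hk : k < n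
    · have := hstep k hk
      have := hsum k hk.le
      have := hba k
      have := hba (k + 1)
      omega
    · have := haN k (by omega)
      have := haN (k + 1) (by omega)
      omega
  · rw [ha k j hj]
    have := haN k
    have := hsum k
    have := hba k
    omega
  · rw [hb k j hj]
    have := haN k
    have := hbN k
    have := hsum k
    have := hba k
    omega

/-- The domino labels attached to a path. -/
noncomputable def pathLabel (n : ℕ) (d : ℕ → ℕ) (c : ℕ × ℕ) : ℕ :=
  if c.2 < n then
    if c.1 = 0 then sInf {k | c.2 < k + d k} else if c.1 = 1 then sInf {k | c.2 + d k < k} else 0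
  else 0

namespace IsPath

variable {n : ℕ} {d : ℕ → ℕ}

lemma pathLabel_top_le (hd : IsPath n d) {j : ℕ} (hj : j < n) (k : ℕ) :
    pathLabel n d (0, j) ≤ k ↔ j < k + d k := by
  have hmono : Monotone fun k => k + d k :=
    monotone_nat_of_le_succ fun k => by have := hd.step k; omega
  have hne : {k | j < k + d k}.Nonempty := ⟨n, by simp; omega⟩
  simp only [pathLabel, hj, if_true]
  have hmem : j < sInf {k | j < k + d k} + d (sInf {k | j < k + d k}) := Nat.sInf_mem hne
  exact ⟨fun h => hmem.trans_le (hmono h), fun h => Nat.sInf_le h⟩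

lemma pathLabel_bottom_le (hd : IsPath n d) {j : ℕ} (hj : j < n) (k : ℕ) :
    pathLabel n d (1, j) ≤ k ↔ j + d k < k := by
  have hmono : Monotone fun k => k - d k :=
    monotone_nat_of_le_succ fun k => by have := hd.step k; omega
  have hne : {k | j + d k < k}.Nonempty := ⟨n, by simp [hd.eq_zero n le_rfl, hj]⟩
  simp only [pathLabel, hj, if_true, one_ne_zero, if_false]
  refine ⟨fun h => ?_, fun h => Nat.sInf_le h⟩
  have h1 : j + d (sInf {k | j + d k < k}) < sInf {k | j + d k < k} := Nat.sInf_mem hne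
  have h2 := hmono h
  simp only at h2
  omega

lemma pathLabel_top_eq (hd : IsPath n d) {j k : ℕ} (hj : j < n) :
    pathLabel n d (0, j) = k + 1 ↔ k + d k ≤ j ∧ j < k + 1 + d (k + 1) := by
  have := hd.pathLabel_top_le hj k
  have := hd.pathLabel_top_le hj (k + 1)
  omega

lemma pathLabel_bottom_eq (hd : IsPath n d) {j k : ℕ} (hj : j < n) :
    pathLabel n d (1, j) = k + 1 ↔ k ≤ j + d k ∧ j + d (k + 1) < k + 1 := by
  have := hd.pathLabel_bottom_le hj k
  have := hd.pathLabel_bottom_le hj (k + 1)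
  omega

lemma pathLabel_ne_zero_iff (hd : IsPath n d) (c : ℕ × ℕ) :
    pathLabel n d c ≠ 0 ↔ c.2 < rectShape 2 n c.1 := by
  obtain ⟨i, j⟩ := c
  rw [lt_rectShape_two]
  by_cases hc : (i = 0 ∨ i = 1) ∧ j < n
  · simp only [hc, and_self, iff_true]
    obtain ⟨rfl | rfl, hj⟩ := hc
    · have := hd.pathLabel_top_le hj 0
      have := hd.zero
      omega
    · have := hd.pathLabel_bottom_le hj 0
      omega
  · simp only [hc, iff_false, not_not, pathLabel]
    grind

lemma pathLabel_le (hd : IsPath n d) (c : ℕ × ℕ) : pathLabel n d c ≤ n := by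
  obtain ⟨i, j⟩ := c
  by_cases hc : (i = 0 ∨ i = 1) ∧ j < n
  · obtain ⟨rfl | rfl, hj⟩ := hc
    · rw [hd.pathLabel_top_le hj]; omega
    · rw [hd.pathLabel_bottom_le hj, hd.eq_zero n le_rfl]; omega
  · have h := (hd.pathLabel_ne_zero_iff (i, j)).not.2 (fun h => hc (lt_rectShape_two.1 h))
    rw [not_not.1 h]
    exact Nat.zero_le _

lemma pathLabel_eq_succ_iff (hd : IsPath n d) {i j k : ℕ} :
    pathLabel n d (i, j) = k + 1 ↔ j < n ∧
      (i = 0 ∧ k + d k ≤ j ∧ j < k + 1 + d (k + 1) ∨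
        i = 1 ∧ k ≤ j + d k ∧ j + d (k + 1) < k + 1) := by
  by_cases hc : (i = 0 ∨ i = 1) ∧ j < n
  · obtain ⟨rfl | rfl, hj⟩ := hc
    · rw [hd.pathLabel_top_eq hj]; simp [hj]
    · rw [hd.pathLabel_bottom_eq hj]; simp [hj]
  · have h := (hd.pathLabel_ne_zero_iff (i, j)).not.2 (fun h => hc (lt_rectShape_two.1 h))
    rw [not_not.1 h]
    omega

lemma add_le (hd : IsPath n d) {k : ℕ} (hk : k ≤ n) : k + d k ≤ n := by
  induction hk using Nat.decreasingInduction with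
  | self => simp [hd.eq_zero n le_rfl]
  | of_succ k hk ih => have := hd.step k; omega

lemma exists_pathLabel_fiber (hd : IsPath n d) {k : ℕ} (hk : k < n) :
    ∃ c c' : ℕ × ℕ, c ≠ c' ∧ DominoAdj c c' ∧
      ∀ e, pathLabel n d e = k + 1 ↔ (e = c ∨ e = c') := by
  have h1 : k + 1 + d (k + 1) ≤ n := hd.add_le hk
  have h2 := hd.le_self k
  rcases hd.step k with h | h | h
  · refine ⟨(0, k + d k), (0, k + d k + 1), by simp, by simp [DominoAdj], fun ⟨i, j⟩ => ?_⟩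
    rw [hd.pathLabel_eq_succ_iff]
    simp only [Prod.mk.injEq]
    omega
  · refine ⟨(1, k - d k), (1, k - d k + 1), by simp, by simp [DominoAdj], fun ⟨i, j⟩ => ?_⟩
    rw [hd.pathLabel_eq_succ_iff]
    simp only [Prod.mk.injEq]
    omega
  · refine ⟨(0, k), (1, k), by simp, by simp [DominoAdj], fun ⟨i, j⟩ => ?_⟩
    rw [hd.pathLabel_eq_succ_iff]
    simp only [Prod.mk.injEq]
    omega

/-- The domino tableau encoded by a path. -/
noncomputable def toTableau (hd : IsPath n d) : DT2 n where
  label := pathLabel n d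
  support := hd.pathLabel_ne_zero_iff
  bounded := hd.pathLabel_le
  fiber_domino k hk hkn := by
    obtain ⟨k, rfl⟩ := Nat.exists_eq_add_of_le' hk
    exact hd.exists_pathLabel_fiber hkn
  row_mono i j j' hjj hj' := by
    obtain ⟨rfl | rfl, hj'⟩ := lt_rectShape_two.1 hj'
    · have := (hd.pathLabel_top_le hj' _).1 le_rfl
      rw [hd.pathLabel_top_le (by omega)]
      omega
    · have := (hd.pathLabel_bottom_le hj' _).1 le_rfl
      rw [hd.pathLabel_bottom_le (by omega)]
      omega
  row_strict i j j' hjj hj' heq := by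
    obtain ⟨k, hk⟩ := Nat.exists_eq_succ_of_ne_zero ((hd.pathLabel_ne_zero_iff (i, j')).2 hj')
    rw [Nat.succ_eq_add_one] at hk
    have h1 := hd.pathLabel_eq_succ_iff.1 hk
    have h2 := hd.pathLabel_eq_succ_iff.1 (heq.trans hk)
    have := hd.step k
    omega
  col_mono i i' j hii hi hi' := by
    obtain ⟨hi, hj⟩ := lt_rectShape_two.1 hi
    obtain ⟨hi', -⟩ := lt_rectShape_two.1 hi'
    rcases hii.eq_or_lt with rfl | hlt
    · exact le_rfl
    · obtain ⟨rfl, rfl⟩ : i = 0 ∧ i' = 1 := by omega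
      have := (hd.pathLabel_bottom_le hj _).1 le_rfl
      rw [hd.pathLabel_top_le hj]
      omega
  col_strict i i' j hii hi hi' _ := by
    have := (lt_rectShape_two.1 hi).1
    have := (lt_rectShape_two.1 hi').1
    omega

lemma encodes_toTableau (hd : IsPath n d) : Encodes hd.toTableau d :=
  ⟨hd, fun _ k hj => hd.pathLabel_top_le hj k, fun _ k hj => hd.pathLabel_bottom_le hj k⟩

end IsPath

lemma bijOn_Phi (n : ℕ) : Set.BijOn (Phi n) (Set.univ : Set (DT2 n))
    {S : Set ℕ | S ⊆ Set.Icc 1 n ∧ S.ncard = n / 2} := by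
  refine ⟨fun D _ => ?_, fun D _ E _ hDE => ?_, fun S hS => ?_⟩
  · obtain ⟨d, hd⟩ := exists_encodes D
    rw [hd.Phi_eq]
    exact ⟨succSet_subset_Icc, by rw [ncard_succSet, hd.path.count_isSelected_eq]⟩
  · obtain ⟨d, hd⟩ := exists_encodes D
    obtain ⟨e, he⟩ := exists_encodes E
    rw [hd.Phi_eq, he.Phi_eq] at hDE
    obtain rfl : d = e := by
      refine hd.path.eq_of_isSelected_iff he.path fun k hk => ?_
      have := Set.ext_iff.1 hDE (k + 1)
      simpa [succ_mem_succSet, hk] using this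
    exact hd.unique he
  · obtain ⟨hsub, hcard⟩ := hS
    have hSs := eq_succSet_of_subset_Icc hsub
    rw [hSs, ncard_succSet] at hcard
    obtain ⟨d, hd, hsel⟩ := exists_isPath_isSelected_iff hcard
    refine ⟨hd.toTableau, trivial, ?_⟩
    rw [hd.encodes_toTableau.Phi_eq, hSs]
    ext x
    rcases x with _ | k
    · simp only [zero_notMem_succSet]
    · rw [succ_mem_succSet, succ_mem_succSet]
      exact and_congr_right fun hk => hsel k hk

lemma ncard_subsets_Icc (n m : ℕ) :
    {S : Set ℕ | S ⊆ Set.Icc 1 n ∧ S.ncard = m}.ncard = n.choose m := by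
  have : {S : Set ℕ | S ⊆ Set.Icc 1 n ∧ S.ncard = m} =
      (fun s : Finset ℕ => (s : Set ℕ)) '' ↑(Finset.powersetCard m (Finset.Icc 1 n)) := by
    ext S
    constructor
    · rintro ⟨hsub, hcard⟩
      obtain ⟨s, rfl⟩ := ((Set.finite_Icc 1 n).subset hsub).exists_finset_coe
      refine ⟨s, ?_, rfl⟩
      rw [Set.ncard_coe_finset] at hcard
      simpa [Finset.mem_powersetCard, hcard, ← Finset.coe_subset] using hsub
    · rintro ⟨s, hs, rfl⟩
      obtain ⟨hsub, hcard⟩ := Finset.mem_powersetCard.1 (Finset.mem_coe.1 hs)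
      refine ⟨?_, by simpa using hcard⟩
      simpa [← Finset.coe_subset] using hsub
  rw [this, Set.ncard_image_of_injective _ Finset.coe_injective, Set.ncard_coe_finset,
    Finset.card_powersetCard, Nat.card_Icc, Nat.add_sub_cancel]

/-- For every positive integer `n`, the number of domino tableaux of
shape `(n, n)` is the central binomial coefficient `C(n, ⌊n/2⌋)`; more precisely, the map
`Φ` is a bijection from `DT((n,n))` onto the `⌊n/2⌋`-element subsets of `{1, …, n}`. -/
theorem dt_two_row_card_and_Phi_bijective (n : ℕ) (hn : 1 ≤ n) :
    Nat.card (DT2 n) = Nat.choose n (n / 2) ∧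
    Set.BijOn (Phi n) (Set.univ : Set (DT2 n))
      {S : Set ℕ | S ⊆ Set.Icc 1 n ∧ S.ncard = n / 2} := by
  have hbij := bijOn_Phi n
  refine ⟨?_, hbij⟩
  rw [← ncard_subsets_Icc n (n / 2), ← hbij.image_eq, hbij.injOn.ncard_image,
    Set.ncard_univ]
end

section
/- A domino tableau of shape (n,n) is uniquely determined by the set of labels of its bottom horizontal dominoes: if two domino tableaux of shape (n,n) have the same set of labels on their bottom horizontal dominoes, then they are equal (in particular they have the same underlying tiling). -/
open scoped Classical

namespace DominoTableau

theorem lt_of_label_eq {n k i j : ℕ} (D : DT2 n) (hk : 1 ≤ k) (h : D.label (i, j) = k) :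
    i < 2 ∧ j < n := by
  have := (D.support (i, j)).1 (by omega)
  simp only [rectShape] at this
  split_ifs at this <;> omega

/-- A domino of a two-row tableau is vertical, top horizontal, or bottom horizontal. -/
theorem fiber_cases {n k : ℕ} (D : DT2 n) (hk : 1 ≤ k) (hkn : k ≤ n) :
    (∃ j, j < n ∧ ∀ e, D.label e = k ↔ (e = (0, j) ∨ e = (1, j))) ∨
    (∃ j, j + 1 < n ∧ ∀ e, D.label e = k ↔ (e = (0, j) ∨ e = (0, j + 1))) ∨
    (∃ j, j + 1 < n ∧ ∀ e, D.label e = k ↔ (e = (1, j) ∨ e = (1, j + 1))) := by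
  obtain ⟨⟨i, j⟩, ⟨i', j'⟩, -, hadj, hf⟩ := D.fiber_domino k hk hkn
  have h₁ := D.lt_of_label_eq hk ((hf (i, j)).2 (Or.inl rfl))
  have h₂ := D.lt_of_label_eq hk ((hf (i', j')).2 (Or.inr rfl))
  have hswap := fun e => (hf e).trans or_comm
  obtain ⟨hi, hi'⟩ : (i = 0 ∨ i = 1) ∧ (i' = 0 ∨ i' = 1) := by omega
  rcases hadj with ⟨hrow, hcol | hcol⟩ | ⟨hcol, hrow | hrow⟩ <;> dsimp only at hrow hcol
  · subst hrow hcol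
    rcases hi with rfl | rfl
    · exact Or.inr (Or.inl ⟨j, h₂.2, hf⟩)
    · exact Or.inr (Or.inr ⟨j, h₂.2, hf⟩)
  · subst hrow hcol
    rcases hi with rfl | rfl
    · exact Or.inr (Or.inl ⟨j', h₁.2, hswap⟩)
    · exact Or.inr (Or.inr ⟨j', h₁.2, hswap⟩)
  · obtain ⟨rfl, rfl⟩ : i = 0 ∧ i' = 1 := by omega
    subst hcol
    exact Or.inl ⟨j, h₁.2, hf⟩
  · obtain ⟨rfl, rfl⟩ : i = 1 ∧ i' = 0 := by omega
    subst hcol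
    exact Or.inl ⟨j, h₁.2, hswap⟩

/-- If the cells with labels at most `k` agree, the last cell labeled `k` in a row of one tableau
is not to the left of the last such cell of the other. -/
theorem rowEnd_le {n k i j j' : ℕ} (D₁ D₂ : DT2 n) (hk : 1 ≤ k)
    (hS : ∀ e, D₁.label e ≤ k ↔ D₂.label e ≤ k)
    (h₁ : D₁.label (i, j) = k) (h₁' : D₁.label (i, j + 1) ≠ k)
    (h₂ : D₂.label (i, j') = k) : j' ≤ j := by
  by_contra! hlt
  obtain ⟨hi, hj'⟩ := D₂.lt_of_label_eq hk h₂
  have hlen : rectShape 2 n i = n := by simp [rectShape, hi]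
  have hle := (hS (i, j + 1)).2 (h₂ ▸ D₂.row_mono i (j + 1) j' hlt (by omega))
  have hge := D₁.row_mono i j (j + 1) (by omega) (by omega)
  omega

theorem rowEnd_eq {n k i j j' : ℕ} (D₁ D₂ : DT2 n) (hk : 1 ≤ k)
    (hS : ∀ e, D₁.label e ≤ k ↔ D₂.label e ≤ k)
    (h₁ : D₁.label (i, j) = k) (h₁' : D₁.label (i, j + 1) ≠ k)
    (h₂ : D₂.label (i, j') = k) (h₂' : D₂.label (i, j' + 1) ≠ k) : j = j' :=
  le_antisymm (rowEnd_le D₂ D₁ hk (fun e => (hS e).symm) h₂ h₂' h₁)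
    (rowEnd_le D₁ D₂ hk hS h₁ h₁' h₂)

/-- If the cells with labels at most `k` agree, the domino labeled `k` cannot be vertical in one
tableau and top horizontal in the other. -/
theorem not_vertical_and_topHorizontal {n k j j' : ℕ} (D₁ D₂ : DT2 n) (hk : 1 ≤ k)
    (hS : ∀ e, D₁.label e ≤ k ↔ D₂.label e ≤ k) (hj : j < n)
    (h₁ : ∀ e, D₁.label e = k ↔ (e = (0, j) ∨ e = (1, j)))
    (h₂ : ∀ e, D₂.label e = k ↔ (e = (0, j') ∨ e = (0, j' + 1))) : False := by
  have hjj : j = j' + 1 := rowEnd_eq (i := 0) D₁ D₂ hk hS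
    (by simp [h₁]) (by simp [h₁]) (by simp [h₂]) (by simp [h₂, add_assoc])
  have hle := (hS (1, j)).1 ((h₁ (1, j)).2 (Or.inr rfl)).le
  have hge := D₂.col_mono 0 1 j (by omega) (by simpa [rectShape]) (by simpa [rectShape])
  have htop : D₂.label (0, j) = k := by simp [h₂, hjj]
  have hbot : D₂.label (1, j) = k := by omega
  simp [h₂] at hbot

theorem mem_bhSet_of_fiber {n k j : ℕ} (D : DT2 n) (hj : j + 1 < n)
    (h : ∀ e, D.label e = k ↔ (e = (1, j) ∨ e = (1, j + 1))) : k ∈ bhSet n D :=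
  ⟨j, hj, by simp [h], by simp [h]⟩

theorem not_mem_bhSet_of_label_top {n k j : ℕ} (D : DT2 n) (hk : 1 ≤ k) (hkn : k ≤ n)
    (h : D.label (0, j) = k) : k ∉ bhSet n D := by
  rintro ⟨m, -, h₁, h₂⟩
  obtain ⟨l, -, hf⟩ | ⟨l, -, hf⟩ | ⟨l, -, hf⟩ := D.fiber_cases hk hkn
  all_goals
    rw [hf] at h h₁ h₂
    simp at h h₁ h₂
  omega

/-- If the cells with labels at most `k` agree, and `k` labels a bottom horizontal domino in both
tableaux or in neither, then the domino labeled `k` is the same in both. -/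
theorem label_eq_iff {n k : ℕ} (D₁ D₂ : DT2 n) (hk : 1 ≤ k) (hkn : k ≤ n)
    (h : bhSet n D₁ = bhSet n D₂) (hS : ∀ e, D₁.label e ≤ k ↔ D₂.label e ≤ k) (e : ℕ × ℕ) :
    D₁.label e = k ↔ D₂.label e = k := by
  have hS' := fun e => (hS e).symm
  obtain ⟨j, hj, h₁⟩ | ⟨j, hj, h₁⟩ | ⟨j, hj, h₁⟩ := D₁.fiber_cases hk hkn <;>
  obtain ⟨j', hj', h₂⟩ | ⟨j', hj', h₂⟩ | ⟨j', hj', h₂⟩ := D₂.fiber_cases hk hkn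
  · obtain rfl : j = j' := rowEnd_eq (i := 0) D₁ D₂ hk hS
      (by simp [h₁]) (by simp [h₁]) (by simp [h₂]) (by simp [h₂])
    rw [h₁, h₂]
  · exact (not_vertical_and_topHorizontal D₁ D₂ hk hS hj h₁ h₂).elim
  · exact (D₁.not_mem_bhSet_of_label_top hk hkn ((h₁ (0, j)).2 (Or.inl rfl))
      (h ▸ D₂.mem_bhSet_of_fiber hj' h₂)).elim
  · exact (not_vertical_and_topHorizontal D₂ D₁ hk hS' hj' h₂ h₁).elim
  · obtain rfl : j = j' := Nat.succ_injective <| rowEnd_eq (i := 0) D₁ D₂ hk hS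
      (by simp [h₁]) (by simp [h₁, add_assoc]) (by simp [h₂]) (by simp [h₂, add_assoc])
    rw [h₁, h₂]
  · exact (D₁.not_mem_bhSet_of_label_top hk hkn ((h₁ (0, j)).2 (Or.inl rfl))
      (h ▸ D₂.mem_bhSet_of_fiber hj' h₂)).elim
  · exact (D₂.not_mem_bhSet_of_label_top hk hkn ((h₂ (0, j')).2 (Or.inl rfl))
      (h ▸ D₁.mem_bhSet_of_fiber hj h₁)).elim
  · exact (D₂.not_mem_bhSet_of_label_top hk hkn ((h₂ (0, j')).2 (Or.inl rfl))
      (h ▸ D₁.mem_bhSet_of_fiber hj h₁)).elim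
  · obtain rfl : j = j' := Nat.succ_injective <| rowEnd_eq (i := 1) D₁ D₂ hk hS
      (by simp [h₁]) (by simp [h₁, add_assoc]) (by simp [h₂]) (by simp [h₂, add_assoc])
    rw [h₁, h₂]

theorem label_le_iff {n : ℕ} (D₁ D₂ : DT2 n) (h : bhSet n D₁ = bhSet n D₂) {k : ℕ} (hkn : k ≤ n) :
    ∀ e, D₁.label e ≤ k ↔ D₂.label e ≤ k := by
  induction hkn using Nat.decreasingInduction with
  | self => exact fun e => iff_of_true (D₁.bounded e) (D₂.bounded e)
  | of_succ k hk ih =>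
    intro e
    have hle := ih e
    have heq := label_eq_iff D₁ D₂ (by omega) hk h ih e
    omega

end DominoTableau

/-- A domino tableau of shape `(n, n)` is uniquely determined by the set
of labels of its bottom horizontal dominoes. -/
theorem dt_two_row_determined_by_bottom_horizontal_labels (n : ℕ) (D₁ D₂ : DT2 n)
    (h : bhSet n D₁ = bhSet n D₂) : D₁ = D₂ := by
  have hlabel : D₁.label = D₂.label := funext fun e =>
    le_antisymm ((DominoTableau.label_le_iff D₁ D₂ h (D₂.bounded e) e).2 le_rfl)
      ((DominoTableau.label_le_iff D₁ D₂ h (D₁.bounded e) e).1 le_rfl)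
  cases D₁
  cases D₂
  congr
end

section
/- Let D be a domino tableau of shape (n,n) and let R be the set of labels of the bottom horizontal dominoes of D (the reduced subset). Then for every i ∈ R, one has i−1 ∈ Des(D) if and only if i−1 ∉ R. -/
open scoped Classical

/-- The row (0-indexed) of the northeast-most cell of the domino of `D` labeled `k`:
row `0` if the domino touches the first row, and row `1` otherwise. -/
noncomputable def neRow (n : ℕ) (D : DT2 n) (k : ℕ) : ℕ :=
  if ∃ j : ℕ, j < n ∧ D.label (0, j) = k then 0 else 1

/-- The descent set of a domino tableau `D` of shape `(n, n)`: those `i` for which the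
northeast-most cell of the domino labeled `i + 1` lies in a row strictly below the row of
the northeast-most cell of the domino labeled `i`. -/
def DesD (n : ℕ) (D : DT2 n) : Set ℕ :=
  {i | 1 ≤ i ∧ i + 1 ≤ n ∧ neRow n D i < neRow n D (i + 1)}
/-- A label lies in the reduced subset exactly when its domino does not touch the first row. -/
theorem mem_bhSet_iff_forall_label_ne (n : ℕ) (D : DT2 n) {k : ℕ} (hk : 1 ≤ k) (hkn : k ≤ n) :
    k ∈ bhSet n D ↔ ¬ ∃ j : ℕ, j < n ∧ D.label (0, j) = k := by
  obtain ⟨⟨a, b⟩, ⟨a', b'⟩, -, hadj, hfib⟩ := D.fiber_domino k hk hkn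
  constructor
  · rintro ⟨j, -, h1, h2⟩ ⟨j', -, h0⟩
    rw [hfib, Prod.mk.injEq, Prod.mk.injEq] at h0 h1 h2
    omega
  · intro h
    have cell : ∀ r s : ℕ, D.label (r, s) = k → r = 1 ∧ s < n := by
      intro r s hrs
      have hs := (D.support (r, s)).1 (by omega)
      simp only [rectShape] at hs
      split_ifs at hs with hr
      · have hr0 : r ≠ 0 := by
          rintro rfl
          exact h ⟨s, hs, hrs⟩
        omega
      · omega
    have hc := (hfib (a, b)).2 (Or.inl rfl)
    have hd := (hfib (a', b')).2 (Or.inr rfl)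
    obtain ⟨rfl, hb⟩ := cell _ _ hc
    obtain ⟨rfl, hb'⟩ := cell _ _ hd
    rcases hadj with ⟨-, h | h⟩ | ⟨-, h | h⟩ <;> simp only at h
    · subst h
      exact ⟨b, hb', hc, hd⟩
    · subst h
      exact ⟨b', hb, hd, hc⟩
    · omega
    · omega

/-- The northeast-most cell of a domino is in the second row iff the domino is bottom
horizontal. -/
theorem neRow_eq_ite_mem_bhSet (n : ℕ) (D : DT2 n) {k : ℕ} (hk : 1 ≤ k) (hkn : k ≤ n) :
    neRow n D k = if k ∈ bhSet n D then 1 else 0 := by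
  simp only [neRow, mem_bhSet_iff_forall_label_ne n D hk hkn, ite_not]

/-- The domino labeled `1` touches the first row, so labels in the reduced subset are at
least `2`. -/
theorem two_le_and_le_of_mem_bhSet (n : ℕ) (D : DT2 n) {k : ℕ} (h : k ∈ bhSet n D) :
    2 ≤ k ∧ k ≤ n := by
  obtain ⟨j, hj, h1, -⟩ := id h
  have hkn : k ≤ n := h1 ▸ D.bounded (1, j)
  have hjn : j < n := by omega
  have h0 : D.label (0, j) ≠ 0 := (D.support (0, j)).2 (by simpa [rectShape] using hjn)
  have hle : D.label (0, j) ≤ D.label (1, j) :=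
    D.col_mono 0 1 j (by omega) (by simpa [rectShape] using hjn) (by simpa [rectShape] using hjn)
  have hne : D.label (0, j) ≠ k := fun e =>
    (mem_bhSet_iff_forall_label_ne n D (by omega) hkn).1 h ⟨j, hjn, e⟩
  omega

/-- If `R` is the reduced subset of `D` (the set of labels of its bottom
horizontal dominoes), then for every `i ∈ R`, `i − 1` is a descent of `D` iff `i − 1 ∉ R`. -/
theorem dt_two_row_descent_iff_not_in_reduced (n : ℕ) (D : DT2 n) :
    ∀ i ∈ bhSet n D, (i - 1 ∈ DesD n D ↔ i - 1 ∉ bhSet n D) := by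
  intro i hi
  obtain ⟨h2, hn⟩ := two_le_and_le_of_mem_bhSet n D hi
  have hpred : i - 1 + 1 = i := by omega
  simp only [DesD, Set.mem_ofPred_eq, hpred]
  rw [neRow_eq_ite_mem_bhSet n D (by omega : 1 ≤ i - 1) (by omega),
    neRow_eq_ite_mem_bhSet n D (by omega : 1 ≤ i) hn, if_pos hi]
  split_ifs with h
  · simp [h]
  · simp only [h, not_false_eq_true, iff_true]
    omega
end

section
/- Let D be a domino tableau of shape (n,n), S = Φ(D), H ⊆ S the set of labels in S belonging to bottom horizontal dominoes of D, and V = S∖H the set of labels in S belonging to vertical dominoes. For s ∈ S write H_s = {r ∈ H : r < s} and V_s = {r ∈ V : r < s}. Then for every s ∈ S one has 2|H_s| + |V_s| ≤ s−1; moreover s ∈ H if and only if 2|H_s| + |V_s| < s−1, and s ∈ V if and only if 2|H_s| + |V_s| = s−1. -/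
open scoped Classical

namespace DominoTableau

/-- The number of cells labeled `k` in row `i` of `D`. -/
noncomputable def rowCount {n : ℕ} (D : DT2 n) (i k : ℕ) : ℕ :=
  ((Finset.range n).filter fun j => D.label (i, j) = k).card

/-- The columns of the cells in row `i` of `D` with label smaller than `s`. -/
noncomputable def rowBelow {n : ℕ} (D : DT2 n) (i s : ℕ) : Finset ℕ :=
  (Finset.range n).filter fun j => D.label (i, j) < s

variable {n : ℕ} (D : DT2 n)

theorem label_ne_zero_iff (i j : ℕ) : D.label (i, j) ≠ 0 ↔ i < 2 ∧ j < n := by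
  rw [D.support]
  unfold rectShape
  split_ifs with h <;> simp [h]

theorem label_row_mono {i j j' : ℕ} (hi : i < 2) (hj : j ≤ j') (hj' : j' < n) :
    D.label (i, j) ≤ D.label (i, j') :=
  D.row_mono i j j' hj (by simpa [rectShape, hi] using hj')

theorem label_top_le_bottom {j : ℕ} (hj : j < n) : D.label (0, j) ≤ D.label (1, j) :=
  D.col_mono 0 1 j zero_le_one (by simpa [rectShape] using hj) (by simpa [rectShape] using hj)

/-- Each domino is top horizontal, bottom horizontal or vertical. -/
theorem exists_fiber {k : ℕ} (hk : 1 ≤ k) (hkn : k ≤ n) : ∃ j,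
    (j + 1 < n ∧ ∀ e, D.label e = k ↔ e = (0, j) ∨ e = (0, j + 1)) ∨
    (j + 1 < n ∧ ∀ e, D.label e = k ↔ e = (1, j) ∨ e = (1, j + 1)) ∨
    (j < n ∧ ∀ e, D.label e = k ↔ e = (0, j) ∨ e = (1, j)) := by
  obtain ⟨⟨i, j⟩, ⟨i', j'⟩, -, hadj, hf⟩ := D.fiber_domino k hk hkn
  have hc := (D.label_ne_zero_iff i j).1 (by rw [(hf _).2 (Or.inl rfl)]; omega)
  have hd := (D.label_ne_zero_iff i' j').1 (by rw [(hf _).2 (Or.inr rfl)]; omega)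
  obtain ⟨hi, hj⟩ := hc
  obtain ⟨hi', hj'⟩ := hd
  have hf' : ∀ e, D.label e = k ↔ e = (i', j') ∨ e = (i, j) := fun e => (hf e).trans or_comm
  simp only [DominoAdj] at hadj
  obtain ⟨rfl, rfl | rfl⟩ | ⟨rfl, rfl | rfl⟩ := hadj
  · interval_cases i
    · exact ⟨j, Or.inl ⟨hj', hf⟩⟩
    · exact ⟨j, Or.inr (Or.inl ⟨hj', hf⟩)⟩
  · interval_cases i
    · exact ⟨j', Or.inl ⟨hj, hf'⟩⟩
    · exact ⟨j', Or.inr (Or.inl ⟨hj, hf'⟩)⟩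
  · obtain rfl : i = 0 := by omega
    exact ⟨j, Or.inr (Or.inr ⟨hj, hf⟩)⟩
  · obtain rfl : i' = 0 := by omega
    exact ⟨j, Or.inr (Or.inr ⟨hj, hf'⟩)⟩

theorem rowCount_eq_card {i k : ℕ} {t : Finset ℕ}
    (h : ∀ j, j < n ∧ D.label (i, j) = k ↔ j ∈ t) : D.rowCount i k = t.card := by
  unfold rowCount
  congr 1
  ext j
  simpa using h j

/-- The type of a domino determines the number of its cells in each row. -/
theorem domino_cases {k : ℕ} (hk : 1 ≤ k) (hkn : k ≤ n) :
    (k ∉ bhSet n D ∧ k ∉ vertSet n D ∧ D.rowCount 0 k = 2 ∧ D.rowCount 1 k = 0) ∨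
    (k ∈ bhSet n D ∧ k ∉ vertSet n D ∧ D.rowCount 0 k = 0 ∧ D.rowCount 1 k = 2) ∨
    (k ∉ bhSet n D ∧ k ∈ vertSet n D ∧ D.rowCount 0 k = 1 ∧ D.rowCount 1 k = 1) := by
  obtain ⟨j, ⟨hj, hf⟩ | ⟨hj, hf⟩ | ⟨hj, hf⟩⟩ := D.exists_fiber hk hkn
  · refine Or.inl ⟨?_, ?_, ?_, ?_⟩
    · simp [bhSet, IsBottomHorizontal, hf]
    · simp [vertSet, IsVertical, hf]
    · rw [D.rowCount_eq_card (t := {j, j + 1}) (by simp [hf]; omega)]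
      simp
    · rw [D.rowCount_eq_card (t := ∅) (by simp [hf])]
      simp
  · refine Or.inr (Or.inl ⟨⟨j, hj, by simp [hf]⟩, ?_, ?_, ?_⟩)
    · simp [vertSet, IsVertical, hf]
    · rw [D.rowCount_eq_card (t := ∅) (by simp [hf])]
      simp
    · rw [D.rowCount_eq_card (t := {j, j + 1}) (by simp [hf]; omega)]
      simp
  · refine Or.inr (Or.inr ⟨?_, ⟨j, hj, by simp [hf]⟩, ?_, ?_⟩)
    · simp only [bhSet, IsBottomHorizontal, hf, Set.mem_ofPred_eq, Prod.mk.injEq]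
      omega
    · rw [D.rowCount_eq_card (t := {j}) (by simp [hf]; omega)]
      simp
    · rw [D.rowCount_eq_card (t := {j}) (by simp [hf]; omega)]
      simp

theorem card_rowBelow {i : ℕ} (hi : i < 2) (s : ℕ) :
    (D.rowBelow i s).card = ∑ k ∈ Finset.Ico 1 s, D.rowCount i k := by
  rw [Finset.card_eq_sum_card_fiberwise (f := fun j => D.label (i, j)) (t := Finset.Ico 1 s)]
  · refine Finset.sum_congr rfl fun k hk => ?_
    rw [Finset.mem_Ico] at hk
    unfold rowCount rowBelow
    rw [Finset.filter_filter]
    congr 1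
    ext j
    simp only [Finset.mem_filter]
    grind
  · intro j hj
    simp only [rowBelow, Finset.coe_filter, Finset.mem_range, Set.mem_ofPred_eq] at hj
    have := (D.label_ne_zero_iff i j).2 ⟨hi, hj.1⟩
    simp only [Finset.coe_Ico, Set.mem_Ico]
    omega

/-- The dominoes with label below `s` cover `2 * (s - 1)` cells. -/
theorem card_rowBelow_add {s : ℕ} (hs : s ≤ n + 1) :
    (D.rowBelow 0 s).card + (D.rowBelow 1 s).card = 2 * (s - 1) := by
  rw [D.card_rowBelow (by omega), D.card_rowBelow (by omega), ← Finset.sum_add_distrib,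
    Finset.sum_const_nat (m := 2), Nat.card_Ico, mul_comm]
  intro k hk
  rw [Finset.mem_Ico] at hk
  have := D.domino_cases hk.1 (by omega)
  omega

theorem bhSet_subset_Icc : bhSet n D ⊆ Set.Icc 1 n := by
  rintro k ⟨j, hj, rfl, -⟩
  exact ⟨Nat.one_le_iff_ne_zero.2 ((D.label_ne_zero_iff 1 j).2 ⟨by omega, by omega⟩), D.bounded _⟩

theorem vertSet_subset_Icc : vertSet n D ⊆ Set.Icc 1 n := by
  rintro k ⟨j, hj, rfl, -⟩
  exact ⟨Nat.one_le_iff_ne_zero.2 ((D.label_ne_zero_iff 0 j).2 ⟨by omega, hj⟩), D.bounded _⟩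

theorem ncard_inter_Iio {A : Set ℕ} (hA : A ⊆ Set.Icc 1 n) (s : ℕ) :
    (A ∩ Set.Iio s).ncard = ∑ k ∈ Finset.Ico 1 s, if k ∈ A then 1 else 0 := by
  rw [← Finset.card_filter, ← Set.ncard_coe_finset]
  congr 1
  ext k
  have := @hA k
  simp only [Set.mem_inter_iff, Set.mem_Iio, Finset.coe_filter, Finset.mem_Ico, Set.mem_ofPred_eq]
  grind

/-- The bottom row cells with label below `s` belong to bottom horizontal dominoes, which cover
two of them each, or to vertical dominoes, which cover one. -/
theorem two_mul_ncard_add_ncard {s : ℕ} (hs : s ≤ n + 1) :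
    2 * (bhSet n D ∩ Set.Iio s).ncard + (vertSet n D ∩ Set.Iio s).ncard =
      (D.rowBelow 1 s).card := by
  rw [ncard_inter_Iio D.bhSet_subset_Icc, ncard_inter_Iio D.vertSet_subset_Icc,
    D.card_rowBelow (by omega), Finset.mul_sum, ← Finset.sum_add_distrib]
  refine Finset.sum_congr rfl fun k hk => ?_
  rw [Finset.mem_Ico] at hk
  obtain ⟨h, h', -, h1⟩ | ⟨h, h', -, h1⟩ | ⟨h, h', -, h1⟩ := D.domino_cases hk.1 (by omega) <;>
    simp [h, h', h1]

theorem rowBelow_subset_range {i j s : ℕ} (hi : i < 2) (hs : s ≤ D.label (i, j)) :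
    D.rowBelow i s ⊆ Finset.range j := by
  intro j' hj'
  simp only [rowBelow, Finset.mem_filter, Finset.mem_range] at hj' ⊢
  by_contra! h
  have := D.label_row_mono hi h hj'.1
  omega

theorem card_rowBelow_lt_of_mem_bhSet {s : ℕ} (h : s ∈ bhSet n D) :
    (D.rowBelow 1 s).card < s - 1 := by
  obtain ⟨hs, hsn⟩ := D.bhSet_subset_Icc h
  obtain ⟨j, hj, hj0, hj1⟩ := id h
  have hbot := Finset.card_le_card (D.rowBelow_subset_range (by omega : 1 < 2) hj0.ge)
  have htop : Finset.range (j + 2) ⊆ D.rowBelow 0 s := by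
    intro j' hj'
    rw [Finset.mem_range] at hj'
    have hmono := D.label_row_mono (by omega : 0 < 2) (by omega : j' ≤ j + 1) hj
    have hcol := D.label_top_le_bottom hj
    have hne : D.label (0, j') ≠ s := by
      have hcount : D.rowCount 0 s = 0 := by
        have := D.domino_cases hs hsn
        tauto
      rw [rowCount, Finset.card_eq_zero, Finset.filter_eq_empty_iff] at hcount
      exact hcount (Finset.mem_range.2 (by omega))
    simp only [rowBelow, Finset.mem_filter, Finset.mem_range]
    omega
  have htop := Finset.card_le_card htop
  have := D.card_rowBelow_add (by omega : s ≤ n + 1)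
  simp only [Finset.card_range] at hbot htop
  omega

theorem card_rowBelow_eq_of_mem_vertSet {s : ℕ} (h : s ∈ vertSet n D) :
    (D.rowBelow 1 s).card = s - 1 := by
  obtain ⟨hs, hsn⟩ := D.vertSet_subset_Icc h
  obtain ⟨j, hj, hj0, hj1⟩ := id h
  have hcount : D.rowCount 0 s = 1 ∧ D.rowCount 1 s = 1 := by
    have := D.domino_cases hs hsn
    tauto
  have key : ∀ i < 2, D.label (i, j) = s → D.rowCount i s = 1 → (D.rowBelow i s).card = j := by
    intro i hi hij hone
    suffices D.rowBelow i s = Finset.range j by rw [this, Finset.card_range]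
    refine (D.rowBelow_subset_range hi hij.ge).antisymm fun j' hj' => ?_
    rw [Finset.mem_range] at hj'
    have hmono := D.label_row_mono hi hj'.le hj
    have hne : D.label (i, j') ≠ s := fun heq => hj'.ne <|
      Finset.card_le_one.1 (by rw [rowCount] at hone; exact hone.le) _ (by simp [heq]; omega) _
        (by simp [hij, hj])
    simp only [rowBelow, Finset.mem_filter, Finset.mem_range]
    omega
  have h0 := key 0 (by omega) hj0 hcount.1
  have h1 := key 1 (by omega) hj1 hcount.2
  have := D.card_rowBelow_add (by omega : s ≤ n + 1)
  omega

theorem mem_vertSet_of_mem_Phi_diff {s : ℕ} (h : s ∈ Phi n D \ bhSet n D) : s ∈ vertSet n D :=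
  (h.1.resolve_left h.2).1

/-- A vertical label smaller than a vertical label selected by `Φ` is selected too. -/
theorem Phi_diff_inter_Iio {s : ℕ} (h : s ∈ Phi n D \ bhSet n D) :
    (Phi n D \ bhSet n D) ∩ Set.Iio s = vertSet n D ∩ Set.Iio s := by
  ext v
  refine ⟨fun hv => ⟨D.mem_vertSet_of_mem_Phi_diff hv.1, hv.2⟩, fun ⟨hv, hvs⟩ => ⟨⟨?_, ?_⟩, hvs⟩⟩
  · refine Or.inr ⟨hv, le_trans (Set.ncard_le_ncard ?_ ?_) (h.1.resolve_left h.2).2⟩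
    · exact Set.inter_subset_inter_right _ (Set.Iic_subset_Iic.2 (le_of_lt hvs))
    · exact (Set.finite_Iic s).inter_of_right _
  · obtain ⟨h1, h2⟩ := D.vertSet_subset_Icc hv
    have := D.domino_cases h1 h2
    tauto

end DominoTableau

/-- Let `S = Φ(D)`, `H ⊆ S` the labels in `S` of bottom horizontal
dominoes, `V = S \ H` the labels in `S` of vertical dominoes, and for `s ∈ S` let
`H_s = {r ∈ H : r < s}` and `V_s = {r ∈ V : r < s}`.  Then `2|H_s| + |V_s| ≤ s − 1`;
moreover `s ∈ H ↔ 2|H_s| + |V_s| < s − 1` and `s ∈ V ↔ 2|H_s| + |V_s| = s − 1`. -/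
theorem dt_two_row_inequality_decides_H_or_V (n : ℕ) (D : DT2 n) :
    ∀ s ∈ Phi n D,
      2 * (bhSet n D ∩ Set.Iio s).ncard + ((Phi n D \ bhSet n D) ∩ Set.Iio s).ncard
          ≤ s - 1 ∧
      (s ∈ bhSet n D ↔
        2 * (bhSet n D ∩ Set.Iio s).ncard + ((Phi n D \ bhSet n D) ∩ Set.Iio s).ncard
          < s - 1) ∧
      (s ∈ Phi n D \ bhSet n D ↔
        2 * (bhSet n D ∩ Set.Iio s).ncard + ((Phi n D \ bhSet n D) ∩ Set.Iio s).ncard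
          = s - 1) := by
  intro s hs
  have hV : ((Phi n D \ bhSet n D) ∩ Set.Iio s).ncard ≤ (vertSet n D ∩ Set.Iio s).ncard :=
    Set.ncard_le_ncard
      (Set.inter_subset_inter_left _ fun _ => D.mem_vertSet_of_mem_Phi_diff)
      ((Set.finite_Iio s).inter_of_right _)
  by_cases hb : s ∈ bhSet n D
  · have hcount := D.two_mul_ncard_add_ncard
      (le_trans (D.bhSet_subset_Icc hb).2 (Nat.le_succ n))
    have hlt := D.card_rowBelow_lt_of_mem_bhSet hb
    simp only [hb, Set.mem_sdiff, not_true_eq_false, and_false, true_iff, false_iff]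
    omega
  · have hv := D.mem_vertSet_of_mem_Phi_diff ⟨hs, hb⟩
    have hcount := D.two_mul_ncard_add_ncard
      (le_trans (D.vertSet_subset_Icc hv).2 (Nat.le_succ n))
    have heq := D.card_rowBelow_eq_of_mem_vertSet hv
    rw [D.Phi_diff_inter_Iio ⟨hs, hb⟩]
    simp only [hb, hs, Set.mem_sdiff, not_false_eq_true, and_self, true_iff, false_iff]
    omega
end

section
/- Let n be an even positive integer and let k be a positive divisor of n. Then the number of subsets S of Z/nZ with |S| = n/2 and S + k = S equals C(k, k/2) if k is even, and equals 0 if k is odd. -/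
/-- The preimage of a finset under a surjective homomorphism of finite additive groups has
proportional size. -/
theorem card_filter_mem_mul_card_of_surjective {G H : Type*} [AddGroup G] [AddGroup H]
    [Fintype G] [Fintype H] [DecidableEq H] (f : G →+ H) (hf : Function.Surjective f)
    (T : Finset H) :
    (Finset.univ.filter (fun g => f g ∈ T)).card * Fintype.card H =
      T.card * Fintype.card G := by
  have fiber (y : H) : (Finset.univ.filter (fun g => f g = y)).card =
      (Finset.univ.filter (fun g => f g = 0)).card :=
    AddMonoidHom.card_fiber_eq_of_mem_range f (hf y) (hf 0)
  have card_preimage (U : Finset H) : (Finset.univ.filter (fun g => f g ∈ U)).card =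
      U.card * (Finset.univ.filter (fun g => f g = 0)).card := by
    rw [Finset.card_eq_sum_card_fiberwise (f := f) (t := U) (by intro g hg; simpa using hg)]
    rw [← smul_eq_mul, ← Finset.sum_const]
    refine Finset.sum_congr rfl fun y hy => ?_
    rw [← fiber y, Finset.filter_filter]
    congr 1
    ext g
    simp only [Finset.mem_filter, Finset.mem_univ, true_and, and_iff_right_iff_imp]
    rintro rfl
    exact hy
  have huniv := card_preimage Finset.univ
  simp only [Finset.mem_univ, Finset.filter_true, Finset.card_univ] at huniv
  rw [card_preimage, huniv]
  ring

/-- A set of residues modulo `n` that is invariant under translation by a divisor `k` of `n` is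
a union of residue classes modulo `k`. -/
theorem ZMod.mem_of_castHom_eq_of_image_add_eq {n k : ℕ} [NeZero n] (hdvd : k ∣ n)
    {S : Finset (ZMod n)} (hS : S.image (fun s => s + (k : ZMod n)) = S) {a b : ZMod n}
    (ha : a ∈ S) (hab : ZMod.castHom hdvd (ZMod k) a = ZMod.castHom hdvd (ZMod k) b) :
    b ∈ S := by
  have add_mul_mem (m : ℕ) : a + ((k * m : ℕ) : ZMod n) ∈ S := by
    induction m with
    | zero => simpa using ha
    | succ m ih =>
      rw [← hS]
      refine Finset.mem_image.2 ⟨_, ih, ?_⟩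
      push_cast
      ring
  have hzero : ZMod.castHom hdvd (ZMod k) (((b - a).val : ℕ) : ZMod n) = 0 := by
    rw [ZMod.natCast_zmod_val, map_sub, hab, sub_self]
  rw [map_natCast, ZMod.natCast_eq_zero_iff] at hzero
  obtain ⟨m, hm⟩ := hzero
  have hmem := add_mul_mem m
  rwa [← hm, ZMod.natCast_zmod_val, add_sub_cancel] at hmem

/-- Subsets of `ℤ/nℤ` of size `n/2` invariant under translation by `k` correspond to subsets of
`ℤ/kℤ` containing exactly half of the residues. -/
theorem ZMod.card_half_shift_invariant_eq_card_half {n k : ℕ} [NeZero n] [NeZero k]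
    (heven : Even n) (hdvd : k ∣ n) :
    Nat.card {S : Finset (ZMod n) //
        S.card = n / 2 ∧ S.image (fun s => s + (k : ZMod n)) = S} =
      Nat.card {T : Finset (ZMod k) // 2 * T.card = k} := by
  set π := ZMod.castHom hdvd (ZMod k)
  have hsurj : Function.Surjective π := ZMod.castHom_surjective hdvd
  have hπk : π (k : ZMod n) = 0 := by simp
  have card_iff (T : Finset (ZMod k)) :
      (Finset.univ.filter (fun g => π g ∈ T)).card = n / 2 ↔ 2 * T.card = k := by
    have h := card_filter_mem_mul_card_of_surjective π.toAddMonoidHom hsurj T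
    simp only [RingHom.toAddMonoidHom_eq_coe, AddMonoidHom.coe_coe, ZMod.card] at h
    obtain ⟨m, hm⟩ := heven
    have hn : n / 2 = m := by omega
    have hm0 : 0 < m := by have := NeZero.pos n; omega
    have hk0 := NeZero.pos k
    rw [hn]
    constructor
    · intro hc
      rw [hc, hm] at h
      apply Nat.eq_of_mul_eq_mul_left hm0
      linarith
    · intro hc
      apply Nat.eq_of_mul_eq_mul_right hk0
      rw [h, hm]
      linear_combination m * hc
  symm
  refine Nat.card_congr (Equiv.ofBijective (fun T =>
    ⟨Finset.univ.filter (fun g => π g ∈ T.1), (card_iff T.1).2 T.2, ?_⟩) ⟨?_, ?_⟩)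
  · ext g
    simp only [Finset.mem_image, Finset.mem_filter, Finset.mem_univ, true_and]
    constructor
    · rintro ⟨s, hs, rfl⟩
      rwa [map_add, hπk, add_zero]
    · intro hg
      exact ⟨g - k, by rwa [map_sub, hπk, sub_zero], sub_add_cancel _ _⟩
  · intro T U hTU
    ext y
    obtain ⟨g, rfl⟩ := hsurj y
    simpa using Finset.ext_iff.1 (congrArg Subtype.val hTU) g
  · rintro ⟨S, hcard, hS⟩
    have hpre : Finset.univ.filter (fun g => π g ∈ S.image π) = S := by
      ext g
      simp only [Finset.mem_image, Finset.mem_filter, Finset.mem_univ, true_and]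
      constructor
      · rintro ⟨a, ha, hag⟩
        exact ZMod.mem_of_castHom_eq_of_image_add_eq hdvd hS ha hag
      · exact fun hg => ⟨g, hg, rfl⟩
    exact ⟨⟨S.image π, (card_iff _).1 (by rw [hpre, hcard])⟩, Subtype.ext hpre⟩

/-- For `n` even and positive and `k` a positive divisor of `n`, the
number of subsets `S ⊆ ℤ/nℤ` with `|S| = n/2` and `S + k = S` equals `C(k, k/2)` if `k`
is even, and `0` if `k` is odd. -/
theorem zmod_even_half_subset_shift_invariant_card (n k : ℕ) (hpos : 0 < n)
    (heven : Even n) (hk : 0 < k) (hdvd : k ∣ n) :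
    Nat.card {S : Finset (ZMod n) //
        S.card = n / 2 ∧ S.image (fun s => s + (k : ZMod n)) = S} =
      if Even k then Nat.choose k (k / 2) else 0 := by
  have : NeZero n := ⟨hpos.ne'⟩
  have : NeZero k := ⟨hk.ne'⟩
  rw [ZMod.card_half_shift_invariant_eq_card_half heven hdvd]
  split_ifs with h
  · obtain ⟨m, rfl⟩ := h
    have hm : (m + m) / 2 = m := by omega
    rw [hm, Nat.card_eq_fintype_card]
    have hcard := Fintype.card_finset_len (α := ZMod (m + m)) m
    rw [ZMod.card] at hcard
    rw [← hcard]
    exact Fintype.card_congr (Equiv.subtypeEquivRight fun T => by omega)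
  · have : IsEmpty {T : Finset (ZMod k) // 2 * T.card = k} :=
      ⟨fun T => h ⟨T.1.card, by have := T.2; omega⟩⟩
    exact Nat.card_of_isEmpty
end
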